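/- Let Q : g → g be ad-equivariant and homogeneous of degree m ≥ 1, and let h, e ∈ g satisfy [h, e] = 2e. Set y = dQ(e).h and z = Q(e). Then [h, y] = 2(m−1)·y and [h, z] = 2m·z. -/

import Mathlib

section

variable {𝕜 E F : Type*} [NontriviallyNormedField 𝕜] [NormedAddCommGroup E] [NormedSpace 𝕜 E]
  [NormedAddCommGroup F] [NormedSpace 𝕜 F]

/-- Euler's identity for homogeneous maps. -/
theorem fderiv_apply_self_of_homogeneous {Q : E → F} {m : ℕ} {x : E}
    (hQ : DifferentiableAt 𝕜 Q x) (hhom : ∀ t : 𝕜, Q (t • x) = t ^ m • Q x) :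
    fderiv 𝕜 Q x x = (m : 𝕜) • Q x := by
  have hline : HasDerivAt (fun t : 𝕜 => t • x) x 1 := by
    simpa using (hasDerivAt_id (1 : 𝕜)).smul_const x
  have hQ' : HasFDerivAt Q (fderiv 𝕜 Q x) ((1 : 𝕜) • x) := by
    simpa using hQ.hasFDerivAt
  have hcomp : HasDerivAt (fun t : 𝕜 => Q (t • x)) (fderiv 𝕜 Q x x) 1 :=
    hQ'.comp_hasDerivAt 1 hline
  have hpow : HasDerivAt (fun t : 𝕜 => t ^ m • Q x) ((m : 𝕜) • Q x) 1 := by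
    simpa using (hasDerivAt_pow m (1 : 𝕜)).smul_const (Q x)
  simp only [hhom] at hcomp
  exact hcomp.unique hpow

/-- Differentiating an identity `dQ(x).(A x) = B (Q x)` with `A`, `B` linear. -/
theorem fderiv_fderiv_apply_add_of_fderiv_apply_eq {Q : E → F} {A : E →L[𝕜] E} {B : F →L[𝕜] F}
    {x : E} (hQ : DifferentiableAt 𝕜 Q x) (hQ' : DifferentiableAt 𝕜 (fderiv 𝕜 Q) x)
    (hAB : ∀ x, fderiv 𝕜 Q x (A x) = B (Q x)) (v : E) :
    fderiv 𝕜 (fderiv 𝕜 Q) x v (A x) + fderiv 𝕜 Q x (A v) = B (fderiv 𝕜 Q x v) := by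
  have hleft := hQ'.hasFDerivAt.clm_apply (A.hasFDerivAt (x := x))
  have hright : HasFDerivAt (fun x => B (Q x)) (B.comp (fderiv 𝕜 Q x)) x :=
    B.hasFDerivAt.comp x hQ.hasFDerivAt
  simp only [hAB] at hleft
  simpa [add_comm] using DFunLike.congr_fun (hleft.unique hright) v

end

theorem stmt {g : Type*} [NormedAddCommGroup g] [NormedSpace ℂ g] [FiniteDimensional ℂ g]
    -- `lie` is the Lie bracket of the finite-dimensional complex Lie algebra `g`,
    -- given as bilinear data so that it is compatible with the normed space structure.
    (lie : g →ₗ[ℂ] g →ₗ[ℂ] g)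
    (lie_self : ∀ x : g, lie x x = 0)
    (lie_jacobi : ∀ x y z : g, lie x (lie y z) = lie (lie x y) z + lie y (lie x z))
    (Q : g → g) (hQ : ContDiff ℂ ⊤ Q)
    (hQeq : ∀ x y : g, fderiv ℂ Q x (lie y x) = lie y (Q x))
    (m : ℕ) (hm : 1 ≤ m)
    (hhom : ∀ (t : ℂ) (x : g), Q (t • x) = t ^ m • Q x)
    (h e : g) (hhe : lie h e = (2 : ℂ) • e) :
    lie h (fderiv ℂ Q e h) = (2 * ((m : ℂ) - 1)) • fderiv ℂ Q e h ∧
      lie h (Q e) = (2 * (m : ℂ)) • Q e := by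
  have hd : DifferentiableAt ℂ Q e := hQ.differentiable (by simp) e
  have hd' : DifferentiableAt ℂ (fderiv ℂ Q) e :=
    (hQ.fderiv_right (m := 1) le_top).differentiable one_ne_zero e
  have euler (x : g) : fderiv ℂ Q x x = (m : ℂ) • Q x :=
    fderiv_apply_self_of_homogeneous (hQ.differentiable (by simp) x) (hhom · x)
  have hequiv := fderiv_fderiv_apply_add_of_fderiv_apply_eq
    (A := (lie h).toContinuousLinearMap) (B := (lie h).toContinuousLinearMap)
    hd hd' (hQeq · h) h
  have heuler := fderiv_fderiv_apply_add_of_fderiv_apply_eq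
    (A := .id ℂ g) (B := (m : ℂ) • ContinuousLinearMap.id ℂ g) hd hd' euler h
  simp only [LinearMap.coe_toContinuousLinearMap', hhe, lie_self, map_zero, add_zero,
    map_smul] at hequiv
  simp only [smul_apply, ContinuousLinearMap.id_apply] at heuler
  constructor
  · rw [← hequiv, eq_sub_of_add_eq heuler]
    module
  · rw [← hQeq e h, hhe, map_smul, euler, smul_smul]
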